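/- For all x in ℝ³ with x ≠ 0, one has 1/|x| = ∫₀^∞ (16/(π r⁵)) (1_{B(0,r/2)} * 1_{B(0,r/2)})(x) dr, where 1_{B(0,r/2)} is the characteristic function of the ball of radius r/2 centered at the origin and * denotes convolution. -/

import Mathlib

open MeasureTheory

lemma outer_int (d : ℝ) (hd : 0 < d) :
   ∫ r in Set.Ioi d, 16 / (Real.pi * r ^ 5) * (Real.pi / 12 * ((2*r+d)*(r-d)^2)) = 1 / d := by
  have key := integral_Ioi_of_hasDerivAt_of_nonneg' (a := d) (l := 0)
    (g := fun r => 4/3*(-2 * r⁻¹ + 3*d/2 * (r⁻¹)^2 - d^3/4*(r⁻¹)^4))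
    (g' := fun r => 16 / (Real.pi * r ^ 5) * (Real.pi / 12 * ((2*r+d)*(r-d)^2))) ?_ ?_ ?_
  · rw [key]; field_simp; ring
  · intro r hr
    have hr0 : 0 < r := lt_of_lt_of_le hd hr
    have h1 := hasDerivAt_inv hr0.ne'
    have h2 := (((h1.const_mul (-2)).add ((h1.pow 2).const_mul (3*d/2))).sub
      ((h1.pow 4).const_mul (d^3/4))).const_mul (4/3)
    refine h2.congr_deriv ?_
    have := Real.pi_pos
    simp only [Nat.cast_ofNat, Nat.reduceSub, inv_pow]
    field_simp
    ring
  · intro r hr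
    have hr0 : 0 < r := lt_trans hd hr
    have := Real.pi_pos
    positivity
  · have h := tendsto_inv_atTop_zero (𝕜 := ℝ)
    have h2 := (((h.const_mul (-2)).add ((h.pow 2).const_mul (3*d/2))).sub
      ((h.pow 4).const_mul (d^3/4))).const_mul (4/3)
    simpa using h2

lemma slice_int (d R : ℝ) (hd : 0 < d) (h : d < 2 * R) :
   ∫ t in (d-R)..R, (R^2 - max (t^2) ((d-t)^2)) = (2*R-d)^2*(4*R+d)/12 := by
  have hc : Continuous (fun t : ℝ => R^2 - max (t^2) ((d-t)^2)) := by fun_prop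
  rw [← intervalIntegral.integral_add_adjacent_intervals (b := d/2) (hc.intervalIntegrable _ _) (hc.intervalIntegrable _ _)]
  have h1 : ∫ t in (d-R)..(d/2), (R^2 - max (t^2) ((d-t)^2)) = ∫ t in (d-R)..(d/2), (R^2 - (d-t)^2) := by
    apply intervalIntegral.integral_congr
    intro t ht
    rw [Set.uIcc_of_le (by linarith)] at ht
    simp only
    rw [max_eq_right]
    nlinarith [ht.2]
  have h2 : ∫ t in (d/2)..R, (R^2 - max (t^2) ((d-t)^2)) = ∫ t in (d/2)..R, (R^2 - t^2) := by
    apply intervalIntegral.integral_congr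
    intro t ht
    rw [Set.uIcc_of_le (by linarith)] at ht
    simp only
    rw [max_eq_left]
    nlinarith [ht.1]
  have h3 : ∫ t in (d-R)..(d/2), (R^2 - (d-t)^2) = ∫ t in (d/2)..R, (R^2 - t^2) := by
    rw [intervalIntegral.integral_comp_sub_left (fun t => R^2 - t^2) d]
    congr 1 <;> ring
  rw [h1, h2, h3, intervalIntegral.integral_sub (by simp) (by simp)]
  simp only [intervalIntegral.integral_const, integral_pow, smul_eq_mul]
  push_cast
  ring

lemma isOpen_and_lt {α : Type*} [TopologicalSpace α] (f g : α → ℝ) (c : ℝ)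
    (hf : Continuous f) (hg : Continuous g) : IsOpen {a | f a < c ∧ g a < c} := by
  exact (isOpen_lt hf continuous_const).inter (isOpen_lt hg continuous_const)

lemma disc_vol (c : ℝ) :
    volume {w : Fin 2 → ℝ | w 0 ^ 2 + w 1 ^ 2 < c} = ENNReal.ofReal (Real.pi * max c 0) := by
  have h := (PiLp.volume_preserving_toLp (Fin 2)).measure_preimage
    (s := Metric.ball (0 : EuclideanSpace ℝ (Fin 2)) (√c)) measurableSet_ball.nullMeasurableSet
  have e : (WithLp.toLp 2) ⁻¹' (Metric.ball (0 : EuclideanSpace ℝ (Fin 2)) (√c)) =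
      {w : Fin 2 → ℝ | w 0 ^ 2 + w 1 ^ 2 < c} := by
    ext w
    simp only [Set.mem_preimage, mem_ball_zero_iff, Set.mem_ofPred_eq, EuclideanSpace.norm_eq,
      Fin.sum_univ_two, Real.norm_eq_abs, sq_abs]
    exact Real.sqrt_lt_sqrt_iff (by positivity)
  rw [e] at h
  rw [h, EuclideanSpace.volume_ball_fin_two, ← ENNReal.ofReal_pow (Real.sqrt_nonneg _)]
  rw [← ENNReal.ofReal_mul (by positivity), mul_comm]
  congr 2
  rcases le_total c 0 with hc | hc
  · simp [Real.sqrt_eq_zero_of_nonpos hc, hc]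
  · simp [Real.sq_sqrt hc, hc]

lemma lens_coord (d R : ℝ) (hd : 0 < d) :
    (volume {z : Fin 3 → ℝ | z 0 ^ 2 + (z 1 ^ 2 + z 2 ^ 2) < R ^ 2 ∧
      (d - z 0) ^ 2 + (z 1 ^ 2 + z 2 ^ 2) < R ^ 2}) =
      ∫⁻ t : ℝ, ENNReal.ofReal (Real.pi * max (R^2 - max (t^2) ((d-t)^2)) 0) := by
  set S : Set (ℝ × (Fin 2 → ℝ)) := {p | p.1 ^ 2 + (p.2 0 ^ 2 + p.2 1 ^ 2) < R ^ 2 ∧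
      (d - p.1) ^ 2 + (p.2 0 ^ 2 + p.2 1 ^ 2) < R ^ 2} with hS
  have hm : MeasurableSet S := by
    apply IsOpen.measurableSet
    refine isOpen_and_lt _ _ _ ?_ ?_ <;> fun_prop
  have h := (volume_preserving_piFinSuccAbove (fun _ : Fin 3 => ℝ) 0).measure_preimage
    (s := S) hm.nullMeasurableSet
  rw [Measure.volume_eq_prod, Measure.prod_apply hm] at h
  refine Eq.trans (Eq.trans ?_ h) ?_
  · rfl
  apply lintegral_congr
  intro t
  rw [← disc_vol]
  congr 1
  ext w
  simp only [hS, Set.mem_preimage, Set.mem_ofPred_eq]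
  rw [lt_sub_comm, max_lt_iff]
  constructor
  · rintro ⟨h1, h2⟩; constructor <;> linarith
  · rintro ⟨h1, h2⟩; constructor <;> linarith

lemma lens_int (d R : ℝ) (hd : 0 < d) (hR : 0 < R) :
    ∫⁻ t : ℝ, ENNReal.ofReal (Real.pi * max (R^2 - max (t^2) ((d-t)^2)) 0) =
      ENNReal.ofReal (if d < 2 * R then Real.pi * ((2*R-d)^2*(4*R+d)/12) else 0) := by
  split_ifs with h
  · have e : (fun t : ℝ => ENNReal.ofReal (Real.pi * max (R^2 - max (t^2) ((d-t)^2)) 0)) =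
      (Set.Ioc (d-R) R).indicator
        (fun t => ENNReal.ofReal (Real.pi * (R^2 - max (t^2) ((d-t)^2)))) := by
      ext t
      by_cases ht : t ∈ Set.Ioc (d-R) R
      · rw [Set.indicator_of_mem ht, max_eq_left]
        rw [sub_nonneg]
        apply max_le <;> nlinarith [ht.1, ht.2]
      · rw [Set.indicator_of_notMem ht, max_eq_right]
        · simp
        rw [sub_nonpos]
        by_cases h1 : d - R < t
        · have : R < t := by
            by_contra hh
            exact ht ⟨h1, not_lt.mp hh⟩
          exact le_max_of_le_left (by nlinarith)
        · exact le_max_of_le_right (by nlinarith)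
    rw [e, lintegral_indicator measurableSet_Ioc, ← ofReal_integral_eq_lintegral_ofReal,
      integral_const_mul, ← intervalIntegral.integral_of_le (by linarith), slice_int d R hd h]
    · have hc : Continuous (fun t : ℝ => Real.pi * (R^2 - max (t^2) ((d-t)^2))) := by fun_prop
      exact (hc.integrableOn_Icc).mono_set Set.Ioc_subset_Icc_self
    · filter_upwards [ae_restrict_mem measurableSet_Ioc] with t ht
      apply mul_nonneg Real.pi_pos.le
      rw [sub_nonneg]
      apply max_le <;> nlinarith [ht.1, ht.2]
  · rw [ENNReal.ofReal_zero, lintegral_eq_zero_of_ae_eq_zero]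
    refine Filter.Eventually.of_forall fun t => ?_
    simp only [Pi.zero_apply]
    rw [max_eq_right]
    · simp
    rw [sub_nonpos]
    by_cases h1 : R < t
    · exact le_max_of_le_left (by nlinarith)
    · exact le_max_of_le_right (by nlinarith)

lemma lens_vol (x : EuclideanSpace ℝ (Fin 3)) (hx : x ≠ 0) (R : ℝ) (hR : 0 < R) :
    volume {y : EuclideanSpace ℝ (Fin 3) | ‖y‖ < R ∧ ‖x - y‖ < R} =
      ENNReal.ofReal (if ‖x‖ < 2 * R then Real.pi * ((2*R-‖x‖)^2*(4*R+‖x‖)/12) else 0) := by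
  have hd : 0 < ‖x‖ := norm_pos_iff.mpr hx
  rw [← lens_int _ R hd hR, ← lens_coord _ R hd]
  obtain ⟨b, hb⟩ := Orthonormal.exists_orthonormalBasis_extension_of_card_eq (𝕜 := ℝ)
    (E := EuclideanSpace ℝ (Fin 3)) (ι := Fin 3) (by simp)
    (v := fun _ => ‖x‖⁻¹ • x) (s := {0}) (by
      constructor
      · intro i
        simp [Set.domRestrict, norm_smul, hd.ne']
      · intro i j hij
        exact absurd (Subsingleton.elim i j) hij)
  have hb0 : b 0 = ‖x‖⁻¹ • x := hb 0 rfl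
  have hxb : x = ‖x‖ • b 0 := by rw [hb0, smul_smul, mul_inv_cancel₀ hd.ne', one_smul]
  have hrx : b.repr x = ‖x‖ • EuclideanSpace.single 0 1 := by
    conv_lhs => rw [hxb]
    rw [map_smul, b.repr_self]
  have hmp := (PiLp.volume_preserving_ofLp (Fin 3)).comp b.measurePreserving_repr
  have hm : MeasurableSet {z : Fin 3 → ℝ | z 0 ^ 2 + (z 1 ^ 2 + z 2 ^ 2) < R ^ 2 ∧
      (‖x‖ - z 0) ^ 2 + (z 1 ^ 2 + z 2 ^ 2) < R ^ 2} := by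
    apply IsOpen.measurableSet
    refine isOpen_and_lt _ _ _ ?_ ?_ <;> fun_prop
  rw [← hmp.measure_preimage hm.nullMeasurableSet]
  congr 1
  ext y
  have n1 : ‖y‖ ^ 2 = (b.repr y) 0 ^ 2 + ((b.repr y) 1 ^ 2 + (b.repr y) 2 ^ 2) := by
    rw [← b.repr.norm_map y, EuclideanSpace.norm_sq_eq]
    simp [Fin.sum_univ_three, add_assoc]
  have n2 : ‖x - y‖ ^ 2 = (‖x‖ - (b.repr y) 0) ^ 2 + ((b.repr y) 1 ^ 2 + (b.repr y) 2 ^ 2) := by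
    rw [← b.repr.norm_map (x - y), map_sub, hrx, EuclideanSpace.norm_sq_eq]
    simp [Fin.sum_univ_three, add_assoc]
  simp only [Set.mem_preimage, Set.mem_ofPred_eq, Function.comp_apply]
  rw [← n1, ← n2, sq_lt_sq₀ (norm_nonneg _) hR.le, sq_lt_sq₀ (norm_nonneg _) hR.le]

theorem fefferman_de_la_llave (x : EuclideanSpace ℝ (Fin 3)) (hx : x ≠ 0) :
    1 / ‖x‖ =
      ∫ r in Set.Ioi (0 : ℝ),
        16 / (Real.pi * r ^ 5) *
          ∫ y : EuclideanSpace ℝ (Fin 3),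
            (Metric.ball (0 : EuclideanSpace ℝ (Fin 3)) (r / 2)).indicator
                (fun _ => (1 : ℝ)) y *
              (Metric.ball (0 : EuclideanSpace ℝ (Fin 3)) (r / 2)).indicator
                (fun _ => (1 : ℝ)) (x - y) := by
  have hd : 0 < ‖x‖ := norm_pos_iff.mpr hx
  have inner (r : ℝ) (hr : 0 < r) : (∫ y : EuclideanSpace ℝ (Fin 3),
            (Metric.ball (0 : EuclideanSpace ℝ (Fin 3)) (r / 2)).indicator
                (fun _ => (1 : ℝ)) y *
              (Metric.ball (0 : EuclideanSpace ℝ (Fin 3)) (r / 2)).indicator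
                (fun _ => (1 : ℝ)) (x - y)) =
      if ‖x‖ < r then Real.pi / 12 * ((2*r+‖x‖)*(r-‖x‖)^2) else 0 := by
    have e : (fun y : EuclideanSpace ℝ (Fin 3) =>
            (Metric.ball (0 : EuclideanSpace ℝ (Fin 3)) (r / 2)).indicator
                (fun _ => (1 : ℝ)) y *
              (Metric.ball (0 : EuclideanSpace ℝ (Fin 3)) (r / 2)).indicator
                (fun _ => (1 : ℝ)) (x - y)) =
        {y : EuclideanSpace ℝ (Fin 3) | ‖y‖ < r/2 ∧ ‖x - y‖ < r/2}.indicator 1 := by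
      ext y
      by_cases h1 : ‖y‖ < r/2 <;> by_cases h2 : ‖x - y‖ < r/2 <;>
        simp [Set.indicator, h1, h2]
    have hm : MeasurableSet {y : EuclideanSpace ℝ (Fin 3) | ‖y‖ < r/2 ∧ ‖x - y‖ < r/2} := by
      apply IsOpen.measurableSet
      refine isOpen_and_lt _ _ _ ?_ ?_ <;> fun_prop
    rw [e, integral_indicator_one hm, measureReal_def, lens_vol x hx _ (by positivity),
      ENNReal.toReal_ofReal]
    · rw [mul_div_cancel₀ r two_ne_zero]
      split_ifs
      · ring
      · rfl
    · split_ifs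
      · have := Real.pi_pos
        positivity
      · rfl
  rw [← outer_int ‖x‖ hd, ← integral_indicator measurableSet_Ioi,
    ← integral_indicator measurableSet_Ioi]
  congr 1
  ext r
  by_cases h0 : 0 < r
  · rw [Set.indicator_of_mem (s := Set.Ioi 0) h0, inner r h0]
    by_cases h1 : ‖x‖ < r
    · rw [Set.indicator_of_mem (s := Set.Ioi ‖x‖) h1, if_pos h1]
    · rw [Set.indicator_of_notMem (s := Set.Ioi ‖x‖) h1, if_neg h1, mul_zero]
  · rw [Set.indicator_of_notMem (s := Set.Ioi 0) h0,
      Set.indicator_of_notMem (s := Set.Ioi ‖x‖) (fun h => h0 (hd.trans h))]
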